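/- arXiv:2101.05257 — 2 statements merged into one kernel-verified Lean document; each statement's English description precedes it below -/
import Mathlib

section
/- Let p_n denote the n-th prime number and let {a_n} be a monotone increasing sequence of positive integers satisfying lim p_n / a_n² = 0 and liminf a_n / p_n = 0. Then the sum ∑_{n=1}^∞ p_n / (∏_{i=1}^n a_i) is irrational. -/
open Filter Finset

/-- By Bertrand's postulate, consecutive primes differ by a factor of at most two. -/
lemma nth_prime_succ_le_two_mul (n : ℕ) :
    Nat.nth Nat.Prime (n + 1) ≤ 2 * Nat.nth Nat.Prime n := by
  obtain ⟨q, hq, hlt, hle⟩ :=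
    Nat.exists_prime_lt_and_le_two_mul _ (Nat.prime_nth_prime n).ne_zero
  refine le_trans ?_ hle
  rw [← Nat.nth_count hq] at hlt ⊢
  exact (Nat.nth_le_nth Nat.infinite_setOfPred_prime).2
    ((Nat.nth_lt_nth Nat.infinite_setOfPred_prime).1 hlt)

lemma theta_sub_theta_le {x y : ℕ} (hxy : x ≤ y) :
    Chebyshev.theta y - Chebyshev.theta x
      ≤ ((Nat.primeCounting y : ℝ) - Nat.primeCounting x) * Real.log y := by
  have hsub := Nat.primesLE_mono hxy
  rw [Chebyshev.theta_eq_sum_primesLE_log, Chebyshev.theta_eq_sum_primesLE_log,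
    ← Nat.primesLE_card_eq_primeCounting, ← Nat.primesLE_card_eq_primeCounting,
    ← Finset.sum_sdiff hsub, add_sub_cancel_right, ← Finset.cast_card_sdiff hsub, ← nsmul_eq_mul]
  refine Finset.sum_le_card_nsmul _ _ _ fun p hp => ?_
  have hp' := Nat.mem_primesLE.1 (Finset.mem_sdiff.1 hp).1
  exact Real.log_le_log (by exact_mod_cast hp'.2.pos) (by exact_mod_cast hp'.1)

lemma eventually_mul_sqrt_lt_primeCounting_sub {T : ℝ} (hT : 0 ≤ T) :
    ∀ᶠ x : ℕ in atTop,
      T * √x < (Nat.primeCounting (4 * x) : ℝ) - Nat.primeCounting x := by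
  have hε : 0 < 1 / (4 * (T + 5)) := by positivity
  have hlog := ((isLittleO_log_rpow_atTop (r := 1 / 2) (by norm_num)).bound hε).natCast_atTop
  have h4 : Tendsto (fun x : ℕ => 4 * x) atTop atTop :=
    tendsto_id.const_mul_atTop' (by norm_num)
  filter_upwards [h4.eventually hlog, eventually_ge_atTop 2] with x hx hx2
  have hx2' : (2 : ℝ) ≤ x := by exact_mod_cast hx2
  set s := √(x : ℝ) with hs
  have hs0 : 0 ≤ s := Real.sqrt_nonneg _
  have hss : s * s = x := Real.mul_self_sqrt (by positivity)
  have hs1 : 1 ≤ s := by nlinarith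
  have hsqrt4 : √((4 * x : ℕ) : ℝ) = 2 * s := by
    rw [Real.sqrt_eq_iff_mul_self_eq (by positivity) (by positivity)]
    push_cast; nlinarith
  have hL0 : 0 < Real.log ((4 * x : ℕ) : ℝ) := Real.log_pos (by push_cast; linarith)
  rw [← Real.sqrt_eq_rpow, hsqrt4, Real.norm_of_nonneg hL0.le,
    Real.norm_of_nonneg (by positivity)] at hx
  have hup := Chebyshev.theta_le_log4_mul_x (x := (x : ℝ)) (by positivity)
  have hlow := Chebyshev.theta_ge (4 * x)
  have hdiff := theta_sub_theta_le (x := x) (y := 4 * x) (by omega)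
  have hlog4 : Real.log 4 = 2 * Real.log 2 := by
    rw [show (4 : ℝ) = 2 ^ 2 by norm_num, Real.log_pow]; norm_num
  have hlogsucc : Real.log (((4 * x : ℕ) : ℝ) + 1) ≤ Real.log ((4 * x : ℕ) : ℝ) + Real.log 2 := by
    rw [← Real.log_mul (by positivity) (by norm_num)]
    exact Real.log_le_log (by positivity) (by push_cast; linarith)
  have hl2 := Real.log_two_gt_d9
  rw [hsqrt4] at hlow
  set L := Real.log ((4 * x : ℕ) : ℝ)
  have hLs : (T + 5) * s * L ≤ x / 2 := by
    calc (T + 5) * s * L ≤ (T + 5) * s * (1 / (4 * (T + 5)) * (2 * s)) := by gcongr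
      _ = s * s / 2 := by field_simp; ring
      _ = x / 2 := by rw [hss]
  refine lt_of_mul_lt_mul_right ?_ hL0.le
  rw [hlog4] at hup
  push_cast at hlow hlogsucc hdiff
  have hxl : (2 * (x : ℝ) - 1) * 0.69 ≤ (2 * x - 1) * Real.log 2 :=
    mul_le_mul_of_nonneg_left (by linarith) (by linarith)
  linarith [mul_le_mul_of_nonneg_right hs1 hL0.le]

/-- For large `N`, the primes in `(p_N, 4 p_N]` outnumber any fixed multiple of `√p_N`. -/
lemma eventually_exists_nth_prime_le_four_mul {T : ℝ} (hT : 0 ≤ T) :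
    ∀ᶠ N : ℕ in atTop, ∃ M, N ≤ M ∧ Nat.nth Nat.Prime M ≤ 4 * Nat.nth Nat.Prime N ∧
      T * √(Nat.nth Nat.Prime N : ℝ) < (M : ℝ) - N := by
  have htend := (Nat.nth_strictMono Nat.infinite_setOfPred_prime).tendsto_atTop
  filter_upwards [htend.eventually (eventually_mul_sqrt_lt_primeCounting_sub hT)] with N hN
  have hcount : Nat.primeCounting (Nat.nth Nat.Prime N) = N + 1 := by
    rw [Nat.primeCounting, Nat.primeCounting', Nat.count_succ,
      if_pos (Nat.prime_nth_prime N)]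
    exact congrArg (· + 1) (Nat.primeCounting'_nth_eq N)
  have hle : N + 1 ≤ Nat.primeCounting (4 * Nat.nth Nat.Prime N) := by
    rw [← hcount]
    exact Nat.monotone_primeCounting (by omega)
  obtain ⟨M, hM⟩ := Nat.exists_eq_add_of_le hle
  rw [hcount, hM] at hN
  refine ⟨N + M, by omega, ?_, ?_⟩
  · refine Nat.lt_succ_iff.1 (Nat.nth_lt_of_lt_count ?_)
    change N + M < Nat.primeCounting (4 * Nat.nth Nat.Prime N)
    omega
  · push_cast at hN ⊢
    linarith

lemma tsum_nat_add_le_two_mul {t : ℕ → ℝ} {n : ℕ} (ht : Summable t)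
    (hhalf : ∀ k, n ≤ k → t (k + 1) ≤ t k / 2) : ∑' k, t (k + n) ≤ 2 * t n := by
  have hgeom : ∀ k, t (k + n) ≤ t n * (1 / 2) ^ k := by
    intro k
    induction k with
    | zero => simp
    | succ k ih =>
      have := hhalf (k + n) (by omega)
      rw [show k + 1 + n = k + n + 1 by ring, pow_succ]
      linarith
  calc ∑' k, t (k + n) ≤ ∑' k : ℕ, t n * (1 / 2) ^ k :=
        ((summable_nat_add_iff n).2 ht).tsum_le_tsum hgeom (summable_geometric_two.mul_left _)
    _ = 2 * t n := by rw [tsum_mul_left, tsum_geometric_two, mul_comm]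

/-- If `b` at most doubles at each step and `a` tends monotonically to infinity, the scaled tails
of the series `∑ b n / (a 0 ⋯ a n)` are within `4 b n / a n ^ 2` of their first terms. -/
lemma eventually_scaled_tail_mem {a b : ℕ → ℝ} (ha : ∀ n, 0 < a n) (hb : ∀ n, 0 < b n)
    (hmono : Monotone a) (hab : ∀ n, b (n + 1) ≤ 2 * b n) (hlim : Tendsto a atTop atTop) :
    ∀ᶠ n in atTop,
      b n / a n ≤ (∏ i ∈ range n, a i) * (∑' k, b k / ∏ i ∈ range (k + 1), a i
        - ∑ k ∈ range n, b k / ∏ i ∈ range (k + 1), a i) ∧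
      (∏ i ∈ range n, a i) * (∑' k, b k / ∏ i ∈ range (k + 1), a i
        - ∑ k ∈ range n, b k / ∏ i ∈ range (k + 1), a i) ≤ b n / a n + 4 * (b n / a n ^ 2) := by
  set t : ℕ → ℝ := fun k => b k / ∏ i ∈ range (k + 1), a i with ht
  have hP : ∀ n, 0 < ∏ i ∈ range n, a i := fun n => prod_pos fun i _ => ha i
  have htpos : ∀ k, 0 < t k := fun k => div_pos (hb k) (hP _)
  have hstep : ∀ k, t (k + 1) ≤ t k * (2 / a (k + 1)) := by
    intro k
    simp only [ht]
    rw [prod_range_succ _ (k + 1), div_mul_div_comm]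
    exact div_le_div_of_nonneg_right (by linarith [hab k]) (mul_pos (hP _) (ha _)).le
  obtain ⟨N, hN⟩ := eventually_atTop.1 (hlim.eventually_ge_atTop 4)
  have hhalf : ∀ k, N ≤ k → t (k + 1) ≤ t k / 2 := by
    intro k hk
    refine (hstep k).trans ?_
    rw [div_eq_mul_one_div (t k)]
    refine mul_le_mul_of_nonneg_left ?_ (htpos k).le
    rw [div_le_div_iff₀ (ha _) (by norm_num)]
    linarith [hN (k + 1) (by omega)]
  have hsum : Summable t := by
    refine summable_of_ratio_norm_eventually_le (r := 1 / 2) (by norm_num) ?_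
    filter_upwards [eventually_ge_atTop N] with k hk
    rw [Real.norm_of_nonneg (htpos _).le, Real.norm_of_nonneg (htpos _).le]
    linarith [hhalf k hk]
  filter_upwards [eventually_ge_atTop N] with n hn
  have htn : (∏ i ∈ range n, a i) * t n = b n / a n := by
    simp only [ht]
    rw [prod_range_succ, mul_div_assoc', mul_div_mul_left _ _ (hP n).ne']
  have htail : ∑' k, t k - ∑ k ∈ range n, t k = t n + ∑' k, t (k + (n + 1)) := by
    rw [← hsum.sum_add_tsum_nat_add (n + 1), sum_range_succ]; ring
  have htail0 : 0 ≤ ∑' k, t (k + (n + 1)) := tsum_nonneg fun k => (htpos _).le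
  have htail1 : ∑' k, t (k + (n + 1)) ≤ t n * (4 / a n) := by
    refine (tsum_nat_add_le_two_mul hsum fun k hk => hhalf k (by omega)).trans ?_
    calc 2 * t (n + 1) ≤ 2 * (t n * (2 / a (n + 1))) := by gcongr; exact hstep n
      _ ≤ 2 * (t n * (2 / a n)) := by
        have := htpos n
        have := ha n
        gcongr
        exact hmono (Nat.le_succ n)
      _ = t n * (4 / a n) := by ring
  rw [htail, mul_add, htn]
  refine ⟨by linarith [mul_nonneg (hP n).le htail0], ?_⟩
  have : (∏ i ∈ range n, a i) * (t n * (4 / a n)) = 4 * (b n / a n ^ 2) := by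
    rw [← mul_assoc, htn]; ring
  linarith [mul_le_mul_of_nonneg_left htail1 (hP n).le]

/-- If `∑ p n / (a 0 ⋯ a n)` is rational with denominator `B`, then `B p n = a n c n - c (n + 1)`
for some integers `c n`, which are close to `B p n / a n`. -/
lemma exists_int_scaled_tail (a : ℕ → ℤ)
    (ha : ∀ n, 0 < a n) (hmono : Monotone a)
    (hlim : Tendsto (fun n => (Nat.nth Nat.Prime n : ℝ) / (a n : ℝ) ^ 2) atTop (nhds 0))
    (hinf : Tendsto (fun n => (a n : ℝ)) atTop atTop) (q : ℚ)
    (hq : (q : ℝ) = ∑' n : ℕ, (Nat.nth Nat.Prime n : ℝ) / ∏ i ∈ range (n + 1), (a i : ℝ)) :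
    ∃ c : ℕ → ℤ, (∀ n, c (n + 1) = a n * c n - q.den * Nat.nth Nat.Prime n) ∧
      ∀ᶠ n in atTop, (q.den : ℝ) * (Nat.nth Nat.Prime n / a n) ≤ c n ∧
        (c n : ℝ) ≤ q.den * (Nat.nth Nat.Prime n / a n) + 1 / 2 := by
  have ha' : ∀ n, (0 : ℝ) < a n := fun n => by exact_mod_cast ha n
  have hB : (0 : ℝ) < q.den := by exact_mod_cast q.den_pos
  have htail := eventually_scaled_tail_mem (a := fun n => (a n : ℝ))
    (b := fun n => (Nat.nth Nat.Prime n : ℝ)) ha'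
    (fun n => by exact_mod_cast (Nat.prime_nth_prime n).pos)
    (fun m n h => Int.cast_le.2 (hmono h))
    (fun n => by exact_mod_cast nth_prime_succ_le_two_mul n) hinf
  rw [← hq] at htail
  set r : ℕ → ℝ := fun n => (∏ i ∈ range n, (a i : ℝ)) * ((q : ℝ)
    - ∑ k ∈ range n, (Nat.nth Nat.Prime k : ℝ) / ∏ i ∈ range (k + 1), (a i : ℝ)) with hr
  have hrec : ∀ n, r (n + 1) = a n * r n - Nat.nth Nat.Prime n := by
    intro n
    have hP : (∏ i ∈ range n, (a i : ℝ)) ≠ 0 := (prod_pos fun i _ => ha' i).ne'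
    have han := (ha' n).ne'
    simp only [hr]
    rw [sum_range_succ, prod_range_succ]
    field_simp
    ring
  have hint : ∀ n, ∃ z : ℤ, (z : ℝ) = q.den * r n := by
    intro n
    induction n with
    | zero =>
      refine ⟨q.num, ?_⟩
      simp only [hr, range_zero, prod_empty, sum_empty, sub_zero, one_mul]
      exact_mod_cast (Rat.den_mul_eq_num q).symm
    | succ n ih =>
      obtain ⟨z, hz⟩ := ih
      refine ⟨a n * z - q.den * Nat.nth Nat.Prime n, ?_⟩
      rw [hrec]
      push_cast
      rw [hz]
      ring
  choose c hc using hint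
  refine ⟨c, fun n => ?_, ?_⟩
  · have : (c (n + 1) : ℝ) = a n * c n - q.den * Nat.nth Nat.Prime n := by
      rw [hc, hc, hrec]; ring
    exact_mod_cast this
  · have hsmall : ∀ᶠ n in atTop, (Nat.nth Nat.Prime n : ℝ) / (a n : ℝ) ^ 2 < 1 / (8 * q.den) :=
      hlim.eventually_lt_const (by positivity)
    filter_upwards [htail, hsmall] with n ⟨h1, h2⟩ h3
    rw [hc]
    refine ⟨mul_le_mul_of_nonneg_left h1 hB.le, ?_⟩
    calc (q.den : ℝ) * r n
        ≤ q.den * (Nat.nth Nat.Prime n / a n + 4 * (1 / (8 * q.den))) := by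
          refine mul_le_mul_of_nonneg_left (h2.trans ?_) hB.le
          linarith
      _ = q.den * (Nat.nth Nat.Prime n / a n) + 1 / 2 := by field_simp; ring

/-- The map `c ↦ A c - B p` with `p` prime has no fixed point strictly between `B` and `p`. -/
lemma ne_mul_sub_mul_prime {A B c : ℤ} {p : ℕ} (hp : p.Prime) (hB : 0 < B)
    (hBc : B < c) (hcp : c < p) : c ≠ A * c - B * p := by
  intro h
  have hp' : Prime (p : ℤ) := Nat.prime_iff_prime_int.1 hp
  have hp0 : (0 : ℤ) < p := by exact_mod_cast hp.pos
  have heq : c * (A - 1) = p * B := by linarith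
  rcases hp'.dvd_or_dvd (Dvd.intro _ heq.symm) with hd | hd
  · exact absurd (Int.le_of_dvd (by omega) hd) (by omega)
  · obtain ⟨k, hk⟩ := hd
    rw [hk, mul_left_comm] at heq
    have hcB : c ∣ B := Dvd.intro _ (mul_left_cancel₀ hp0.ne' heq)
    exact absurd (Int.le_of_dvd hB hcB) (by omega)

/-- An integer that changes by at most `d + 1 / 2`, and does change, changes by at most
`4 * d - 1`. -/
lemma int_sub_le_of_ne {x y : ℤ} {d : ℝ} (hne : y ≠ x) (hd : 0 ≤ d)
    (h : (y : ℝ) - x ≤ d + 1 / 2) : (y : ℝ) - x ≤ -1 + 4 * d := by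
  rcases lt_or_gt_of_ne hne with hlt | hlt
  · have : (y : ℝ) + 1 ≤ x := by exact_mod_cast hlt
    linarith
  · have : (x : ℝ) + 1 ≤ y := by exact_mod_cast hlt
    linarith

lemma eventually_int_bounded (a c : ℕ → ℤ) (B : ℕ) (hB : 0 < B)
    (ha : ∀ n, 0 < a n) (hmono : Monotone a)
    (hlim : Tendsto (fun n => (Nat.nth Nat.Prime n : ℝ) / (a n : ℝ) ^ 2) atTop (nhds 0))
    (hinf : Tendsto (fun n => (a n : ℝ)) atTop atTop)
    (hrec : ∀ n, c (n + 1) = a n * c n - B * Nat.nth Nat.Prime n)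
    (hc : ∀ᶠ n in atTop, (B : ℝ) * (Nat.nth Nat.Prime n / a n) ≤ c n ∧
        (c n : ℝ) ≤ B * (Nat.nth Nat.Prime n / a n) + 1 / 2) :
    ∀ᶠ n in atTop, (c n : ℝ) ≤ 8 * B + 1 / 2 := by
  have ha' : ∀ n, (0 : ℝ) < a n := fun n => by exact_mod_cast ha n
  have hB' : (0 : ℝ) < B := by exact_mod_cast hB
  have hpmono : StrictMono (Nat.nth Nat.Prime) := Nat.nth_strictMono Nat.infinite_setOfPred_prime
  have hp2 : ∀ n, (2 : ℝ) ≤ Nat.nth Nat.Prime n := fun n => by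
    exact_mod_cast (Nat.prime_nth_prime n).two_le
  have hsq : ∀ᶠ n in atTop, (Nat.nth Nat.Prime n : ℝ) / (a n : ℝ) ^ 2 < 1 :=
    hlim.eventually_lt_const one_pos
  obtain ⟨n₀, hn₀⟩ := eventually_atTop.1 (((hc.and hsq).and
    (hinf.eventually_ge_atTop (2 * B + 2))).and
    (eventually_exists_nth_prime_le_four_mul (T := 21 * B + 1) (by positivity)))
  have hstep : ∀ n, n₀ ≤ n → (B : ℤ) < c n → (c (n + 1) : ℝ) - c n ≤
      -1 + 4 * (B * (((Nat.nth Nat.Prime (n + 1) : ℝ) - Nat.nth Nat.Prime n) / a n)) := by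
    intro n hn hBc
    obtain ⟨⟨⟨⟨hl, hu⟩, -⟩, han⟩, -⟩ := hn₀ n hn
    obtain ⟨⟨⟨⟨-, hu'⟩, -⟩, -⟩, -⟩ := hn₀ (n + 1) (by omega)
    have hpp : (Nat.nth Nat.Prime n : ℝ) ≤ Nat.nth Nat.Prime (n + 1) := by
      exact_mod_cast hpmono.monotone n.le_succ
    refine int_sub_le_of_ne ?_ ?_ ?_
    · intro heq
      rw [hrec] at heq
      refine ne_mul_sub_mul_prime (Nat.prime_nth_prime n) (by exact_mod_cast hB) hBc ?_
        heq.symm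
      · have h1 : (B : ℝ) * (Nat.nth Nat.Prime n / a n) ≤ Nat.nth Nat.Prime n / 2 := by
          rw [mul_div_assoc', div_le_div_iff₀ (ha' n) (by norm_num)]
          nlinarith [hp2 n]
        have : (c n : ℝ) < Nat.nth Nat.Prime n := by linarith [hp2 n]
        exact_mod_cast this
    · exact mul_nonneg hB'.le (div_nonneg (by linarith) (ha' n).le)
    · have h1 : (Nat.nth Nat.Prime (n + 1) : ℝ) / a (n + 1) ≤ Nat.nth Nat.Prime (n + 1) / a n := by
        have := ha' n
        have : (a n : ℝ) ≤ a (n + 1) := by exact_mod_cast hmono n.le_succ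
        gcongr
      rw [sub_div, mul_sub]
      linarith [mul_le_mul_of_nonneg_left h1 hB'.le]
  have hdip : ∀ N, n₀ ≤ N → ∃ n, N ≤ n ∧ c n ≤ B ∧
      Nat.nth Nat.Prime n ≤ 4 * Nat.nth Nat.Prime N := by
    intro N hN
    obtain ⟨⟨⟨⟨-, hu⟩, hs⟩, -⟩, M, hNM, hpM, hM⟩ := hn₀ N hN
    by_contra! hcon
    have hbig : ∀ n, N ≤ n → n ≤ M → (B : ℤ) < c n := by
      intro n h1 h2
      by_contra! h3
      have := hcon n h1 h3
      have := hpmono.monotone h2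
      omega
    have hsum : ∀ k, N + k ≤ M → (c (N + k) : ℝ) ≤ c N - k +
        4 * (B * (((Nat.nth Nat.Prime (N + k) : ℝ) - Nat.nth Nat.Prime N) / a N)) := by
      intro k
      induction k with
      | zero => intro _; simp
      | succ k ih =>
        intro hk
        have h1 := ih (by omega)
        have h2 := hstep (N + k) (by omega) (hbig _ (by omega) (by omega))
        have hpp : (Nat.nth Nat.Prime (N + k) : ℝ) ≤ Nat.nth Nat.Prime (N + k + 1) := by
          exact_mod_cast hpmono.monotone (N + k).le_succ
        have h3 : ((Nat.nth Nat.Prime (N + k + 1) : ℝ) - Nat.nth Nat.Prime (N + k)) / a (N + k) ≤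
            ((Nat.nth Nat.Prime (N + k + 1) : ℝ) - Nat.nth Nat.Prime (N + k)) / a N :=
          div_le_div_of_nonneg_left (by linarith) (ha' N)
            (by exact_mod_cast hmono (Nat.le_add_right N k))
        have h4 := mul_le_mul_of_nonneg_left h3 hB'.le
        rw [← add_assoc]
        have h5 : (B : ℝ) * (((Nat.nth Nat.Prime (N + k + 1) : ℝ) - Nat.nth Nat.Prime N) / a N)
          = B * (((Nat.nth Nat.Prime (N + k) : ℝ) - Nat.nth Nat.Prime N) / a N) +
            B * (((Nat.nth Nat.Prime (N + k + 1) : ℝ) - Nat.nth Nat.Prime (N + k)) / a N) := by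
          ring
        rw [h5]
        push_cast
        linarith
    have hfin := hsum (M - N) (by omega)
    rw [Nat.add_sub_cancel' hNM, Nat.cast_sub hNM] at hfin
    have hcM : (0 : ℝ) < c M := by
      have : (B : ℝ) < c M := by exact_mod_cast hbig M hNM le_rfl
      linarith
    set x := (Nat.nth Nat.Prime N : ℝ)
    have hx0 : 0 ≤ x := by positivity
    have hpa : x / a N ≤ √x := by
      rw [div_lt_one (pow_pos (ha' N) 2)] at hs
      have h1 : √x ≤ a N := (Real.sqrt_le_left (ha' N).le).2 hs.le
      rw [div_le_iff₀ (ha' N)]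
      calc x = √x * √x := (Real.mul_self_sqrt hx0).symm
        _ ≤ √x * a N := by gcongr
    have h1 : ((Nat.nth Nat.Prime M : ℝ) - x) / a N ≤ 4 * (x / a N) := by
      rw [mul_div_assoc']
      have : (Nat.nth Nat.Prime M : ℝ) ≤ 4 * Nat.nth Nat.Prime N := by exact_mod_cast hpM
      exact div_le_div_of_nonneg_right (by linarith) (ha' N).le
    have h2 := mul_le_mul_of_nonneg_left h1 hB'.le
    have h3 := mul_le_mul_of_nonneg_left hpa hB'.le
    have h4 : 1 ≤ √x := Real.one_le_sqrt.2 (by linarith [hp2 N])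
    have h5 : 0 ≤ B * √x := by positivity
    nlinarith
  obtain ⟨m₀, hm₀, hcm₀, -⟩ := hdip n₀ le_rfl
  filter_upwards [eventually_ge_atTop m₀] with n hn
  -- `m` is the last index up to `n` at which `c` is at most `B`.
  obtain ⟨m, ⟨hm0, hmn, hcm⟩, hmax⟩ : ∃ m, (m₀ ≤ m ∧ m ≤ n ∧ c m ≤ B) ∧
      ∀ m', m < m' → m' ≤ n → (B : ℤ) < c m' := by
    classical
    obtain ⟨m, hm, hmax⟩ := Finset.exists_max_image ((Icc m₀ n).filter fun k => c k ≤ B) id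
      ⟨m₀, by simp [hn, hcm₀]⟩
    simp only [Finset.mem_filter, Finset.mem_Icc, id] at hm hmax
    refine ⟨m, ⟨hm.1.1, hm.1.2, hm.2⟩, fun m' h1 h2 => ?_⟩
    by_contra! h3
    exact absurd (hmax m' ⟨⟨by omega, h2⟩, h3⟩) (by omega)
  obtain ⟨⟨⟨⟨hl, -⟩, -⟩, -⟩, -⟩ := hn₀ m (by omega)
  obtain ⟨⟨⟨⟨-, hu⟩, -⟩, -⟩, -⟩ := hn₀ n (by omega)
  have hpn : Nat.nth Nat.Prime n ≤ 8 * Nat.nth Nat.Prime m := by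
    obtain ⟨l, hl1, hl2, hl3⟩ := hdip (m + 1) (by omega)
    have hnl : n ≤ l := by
      by_contra! h
      exact absurd (hmax l (by omega) h.le) (by omega)
    have := hpmono.monotone hnl
    have := nth_prime_succ_le_two_mul m
    omega
  have hpn' : (Nat.nth Nat.Prime n : ℝ) ≤ 8 * Nat.nth Nat.Prime m := by exact_mod_cast hpn
  have hpm : (Nat.nth Nat.Prime m : ℝ) ≤ a m := by
    have h1 : (c m : ℝ) ≤ B := by exact_mod_cast hcm
    have h2 : (B : ℝ) * (Nat.nth Nat.Prime m / a m) ≤ B * 1 := by linarith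
    exact (div_le_one (ha' m)).1 (le_of_mul_le_mul_left h2 hB')
  have hamn : (a m : ℝ) ≤ a n := by exact_mod_cast hmono hmn
  have h8 : (Nat.nth Nat.Prime n : ℝ) / a n ≤ 8 := by
    rw [div_le_iff₀ (ha' n)]
    linarith
  linarith [mul_le_mul_of_nonneg_left h8 hB'.le]

/-- Since the limit inferior of a real sequence is `0` by convention when the sequence tends to
infinity, a vanishing limit inferior leaves two cases. -/
lemma frequently_lt_or_tendsto_atTop_of_liminf_eq_zero {u : ℕ → ℝ} (h : liminf u atTop = 0) :
    (∀ ε > 0, ∃ᶠ n in atTop, u n < ε) ∨ Tendsto u atTop atTop := by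
  by_cases hu : atTop.IsCoboundedUnder (· ≥ ·) u
  · exact Or.inl fun ε hε => frequently_lt_of_liminf_lt hu (h ▸ hε)
  · refine Or.inr (tendsto_atTop.2 fun b => ?_)
    by_contra hb
    refine hu ⟨b, fun x hx => ?_⟩
    by_contra! hxb
    exact hb ((eventually_map.1 hx).mono fun n hn => hxb.le.trans hn)

theorem erdos_straus_thm_3_1 (a : ℕ → ℤ)
    (ha : ∀ n, 0 < a n) (hmono : Monotone a)
    (hlim : Tendsto (fun n => (Nat.nth Nat.Prime n : ℝ) / (a n : ℝ) ^ 2) atTop (nhds 0))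
    (hliminf : Filter.liminf (fun n => (a n : ℝ) / (Nat.nth Nat.Prime n : ℝ)) atTop = 0) :
    Irrational (∑' n : ℕ, (Nat.nth Nat.Prime n : ℝ) / ∏ i ∈ Finset.range (n + 1), (a i : ℝ)) := by
  rintro ⟨q, hq⟩
  have ha' : ∀ n, (0 : ℝ) < a n := fun n => by exact_mod_cast ha n
  have hB : (0 : ℝ) < q.den := by exact_mod_cast q.den_pos
  have hp : ∀ n, (0 : ℝ) < Nat.nth Nat.Prime n := fun n => by
    exact_mod_cast (Nat.prime_nth_prime n).pos
  have hinf : Tendsto (fun n => (a n : ℝ)) atTop atTop := by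
    have hsqrt : Tendsto (fun n : ℕ => √(n : ℝ)) atTop atTop :=
      Real.tendsto_sqrt_atTop.comp tendsto_natCast_atTop_atTop
    refine tendsto_atTop_mono' _ ?_ hsqrt
    filter_upwards [hlim.eventually_lt_const one_pos] with n hn
    rw [div_lt_one (pow_pos (ha' n) 2)] at hn
    refine (Real.sqrt_le_left (ha' n).le).2 (le_trans ?_ hn.le)
    have := Nat.add_two_le_nth_prime n
    exact_mod_cast (by omega : n ≤ Nat.nth Nat.Prime n)
  obtain ⟨c, hrec, hc⟩ := exists_int_scaled_tail a ha hmono hlim hinf q hq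
  rcases frequently_lt_or_tendsto_atTop_of_liminf_eq_zero hliminf with hfreq | htend
  · have hbdd := eventually_int_bounded a c q.den q.den_pos ha hmono hlim hinf hrec hc
    obtain ⟨n, hn, hn', hcn, -⟩ := ((hfreq (1 / 9) (by norm_num)).and_eventually
      (hbdd.and hc)).exists
    rw [div_lt_iff₀ (hp n)] at hn
    have h9 : 9 < (Nat.nth Nat.Prime n : ℝ) / a n := by
      rw [lt_div_iff₀ (ha' n)]
      linarith
    have hB1 : (1 : ℝ) ≤ q.den := by exact_mod_cast q.den_pos
    nlinarith
  · obtain ⟨n, hn, hcl, hcu⟩ :=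
      ((htend.eventually_ge_atTop (4 * (q.den : ℝ))).and hc).exists
    have hpos : (0 : ℝ) < c n :=
      (mul_pos hB (div_pos (hp n) (ha' n))).trans_le hcl
    have hone : (1 : ℝ) ≤ c n := by
      have : 0 < c n := by exact_mod_cast hpos
      exact_mod_cast this
    rw [le_div_iff₀ (hp n)] at hn
    have : (q.den : ℝ) * (Nat.nth Nat.Prime n / a n) ≤ 1 / 4 := by
      rw [mul_div_assoc', div_le_iff₀ (ha' n)]
      linarith
    linarith
end

section
/- If p_n denotes the n-th prime, then lim_{n→∞} p_{n+1}/p_n = 1. -/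
open Filter

/-- One-sided Fejér kernel: its real part is `(1 - cos u) / u ^ 2`. -/
noncomputable def fejerHalf (u : ℝ) : ℂ :=
  ∫ t in (0 : ℝ)..1, ((1 - t : ℝ) : ℂ) * Complex.exp (-((u * t : ℝ) * Complex.I))

lemma fejerHalf_re (u : ℝ) :
    (fejerHalf u).re = ∫ t in (0 : ℝ)..1, (1 - t) * Real.cos (u * t) := by
  have h : IntervalIntegrable (fun t : ℝ => ((1 - t : ℝ) : ℂ) *
      Complex.exp (-((u * t : ℝ) * Complex.I))) MeasureTheory.volume 0 1 :=
    Continuous.intervalIntegrable (by fun_prop) _ _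
  have := Complex.reCLM.intervalIntegral_comp_comm h
  rw [fejerHalf, ← Complex.reCLM_apply, ← this]
  refine intervalIntegral.integral_congr fun t _ => ?_
  simp only [Complex.reCLM_apply, Complex.re_ofReal_mul]
  rw [← neg_mul, ← Complex.ofReal_neg, Complex.exp_ofReal_mul_I_re, Real.cos_neg]

lemma sq_mul_fejerHalf_re (u : ℝ) : u ^ 2 * (fejerHalf u).re = 1 - Real.cos u := by
  rw [fejerHalf_re, ← intervalIntegral.integral_const_mul]
  have hd : ∀ t ∈ Set.uIcc (0 : ℝ) 1,
      HasDerivAt (fun t => (1 - t) * (u * Real.sin (u * t)) - Real.cos (u * t))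
        (u ^ 2 * ((1 - t) * Real.cos (u * t))) t := by
    intro t _
    have hm : HasDerivAt (fun t : ℝ => u * t) u t := by
      simpa using (hasDerivAt_id t).const_mul u
    have h1 : HasDerivAt (fun t : ℝ => 1 - t) (-1) t := by
      simpa using (hasDerivAt_id t).const_sub 1
    convert! (h1.mul ((hm.sin).const_mul u)).sub hm.cos using 1
    ring
  rw [intervalIntegral.integral_eq_sub_of_hasDerivAt hd
    (Continuous.intervalIntegrable (by fun_prop) _ _)]
  simp
  ring

lemma integral_one_sub : ∫ t in (0 : ℝ)..1, (1 - t) = 1 / 2 := by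
  rw [intervalIntegral.integral_sub (by simp) (by simp)]
  norm_num

lemma fejerHalf_re_nonneg (u : ℝ) : 0 ≤ (fejerHalf u).re := by
  rcases eq_or_ne u 0 with rfl | hu
  · rw [fejerHalf_re]
    simp [integral_one_sub]
  · have h := sq_mul_fejerHalf_re u
    have h2 : 0 ≤ u ^ 2 * (fejerHalf u).re := by rw [h]; linarith [Real.cos_le_one u]
    exact nonneg_of_mul_nonneg_right h2 (by positivity)

lemma fejerHalf_re_le_half (u : ℝ) : (fejerHalf u).re ≤ 1 / 2 := by
  rw [fejerHalf_re, ← integral_one_sub]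
  refine intervalIntegral.integral_mono_on zero_le_one
    (Continuous.intervalIntegrable (by fun_prop) _ _)
    (Continuous.intervalIntegrable (by fun_prop) _ _) fun t ht => ?_
  exact mul_le_of_le_one_right (by linarith [ht.2]) (Real.cos_le_one _)

lemma fejerHalf_re_le (u : ℝ) (hu : u ≠ 0) : (fejerHalf u).re ≤ 2 / u ^ 2 := by
  rw [le_div_iff₀ (by positivity), mul_comm, sq_mul_fejerHalf_re]
  linarith [Real.neg_one_le_cos u]

lemma quarter_le_fejerHalf_re {u : ℝ} (h0 : 0 ≤ u) (h1 : u ≤ 1) : 1 / 4 ≤ (fejerHalf u).re := by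
  have : (1 / 4 : ℝ) = ∫ t in (0 : ℝ)..1, (1 - t) * (1 / 2) := by
    rw [intervalIntegral.integral_mul_const, integral_one_sub]; norm_num
  rw [fejerHalf_re, this]
  refine intervalIntegral.integral_mono_on zero_le_one
    (Continuous.intervalIntegrable (by fun_prop) _ _)
    (Continuous.intervalIntegrable (by fun_prop) _ _) fun t ht => ?_
  refine mul_le_mul_of_nonneg_left ?_ (by linarith [ht.2])
  have hut : u * t ≤ 1 := mul_le_one₀ h1 ht.1 ht.2
  have := Real.one_sub_sq_div_two_le_cos (x := u * t)
  nlinarith [mul_nonneg h0 ht.1]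

lemma continuous_fejerHalf : Continuous fejerHalf :=
  intervalIntegral.continuous_parametric_intervalIntegral_of_continuous'
    (f := fun u t : ℝ => ((1 - t : ℝ) : ℂ) * Complex.exp (-((u * t : ℝ) * Complex.I)))
    (by fun_prop) 0 1

lemma hasSum_vonMangoldt_mul_fejerHalf {σ : ℝ} (hσ : 1 < σ) (l x : ℝ) :
    HasSum (fun n : ℕ => (ArithmeticFunction.vonMangoldt n * (n : ℝ) ^ (-σ) : ℝ) *
        fejerHalf (l * (Real.log n - x)))
      (∫ t in (0 : ℝ)..1, ((1 - t : ℝ) : ℂ) * Complex.exp ((l * x * t : ℝ) * Complex.I) *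
        LSeries (fun n => (ArithmeticFunction.vonMangoldt n : ℂ)) (σ + (l * t : ℝ) * Complex.I)) := by
  set a : ℕ → ℝ := fun n => ArithmeticFunction.vonMangoldt n * (n : ℝ) ^ (-σ) with ha
  have ha0 : ∀ n, 0 ≤ a n := fun n =>
    mul_nonneg ArithmeticFunction.vonMangoldt_nonneg (by positivity)
  have hterm : ∀ (n : ℕ) (τ : ℝ), LSeries.term (fun n => (ArithmeticFunction.vonMangoldt n : ℂ))
      (σ + τ * Complex.I) n = a n * Complex.exp (-((Real.log n * τ : ℝ) * Complex.I)) := by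
    intro n τ
    rw [LSeries.term_def₀ (by simp)]
    rcases Nat.eq_zero_or_pos n with rfl | hn
    · simp [ha]
    · have hn' : (n : ℂ) ≠ 0 := by exact_mod_cast hn.ne'
      simp only [ha]
      rw [neg_add, Complex.cpow_add _ _ hn', Complex.ofReal_mul,
        Complex.ofReal_cpow (Nat.cast_nonneg n), Complex.cpow_def_of_ne_zero hn' (-(τ * Complex.I)),
        ← Complex.natCast_log]
      push_cast
      rw [mul_assoc]
      congr 3
      ring
  have hasum : Summable a := by
    have h := (ArithmeticFunction.LSeriesSummable_vonMangoldt (s := (σ : ℂ)) (by simpa)).norm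
    refine h.congr fun n => ?_
    have := hterm n 0
    simp only [Complex.ofReal_zero, zero_mul, add_zero, mul_zero, neg_zero, Complex.exp_zero,
      mul_one] at this
    rw [this, Complex.norm_real, Real.norm_of_nonneg (ha0 n)]
  let F : ℕ → ℝ → ℂ := fun n t => ((1 - t : ℝ) : ℂ) *
    Complex.exp ((l * x * t : ℝ) * Complex.I) *
      (a n * Complex.exp (-((Real.log n * (l * t) : ℝ) * Complex.I)))
  have hFc : ∀ n, Continuous (F n) := fun n => by fun_prop
  have key := intervalIntegral.hasSum_integral_of_dominated_convergence
    (μ := MeasureTheory.volume) (a := (0 : ℝ)) (b := 1) (F := F)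
    (f := fun t => ((1 - t : ℝ) : ℂ) * Complex.exp ((l * x * t : ℝ) * Complex.I) *
        LSeries (fun n => (ArithmeticFunction.vonMangoldt n : ℂ)) (σ + (l * t : ℝ) * Complex.I))
    (fun n _ => a n) (fun n => (hFc n).aestronglyMeasurable) ?_ ?_ ?_ ?_
  · convert! key using 2 with n
    rw [fejerHalf, ← intervalIntegral.integral_const_mul]
    refine intervalIntegral.integral_congr fun t _ => ?_
    simp only [F]
    have hexp : Complex.exp (-((l * (Real.log n - x) * t : ℝ) * Complex.I)) =
        Complex.exp ((l * x * t : ℝ) * Complex.I) *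
          Complex.exp (-((Real.log n * (l * t) : ℝ) * Complex.I)) := by
      rw [← Complex.exp_add]
      push_cast
      ring_nf
    rw [hexp]
    ring
  · intro n
    refine Eventually.of_forall fun t ht => ?_
    rw [Set.uIoc_of_le zero_le_one] at ht
    simp only [F, norm_mul, Complex.norm_real, ← neg_mul, ← Complex.ofReal_neg,
      Complex.norm_exp_ofReal_mul_I, mul_one, Real.norm_of_nonneg (ha0 n)]
    refine mul_le_of_le_one_left (ha0 n) ?_
    rw [Real.norm_of_nonneg] <;> linarith [ht.1, ht.2]
  · exact Eventually.of_forall fun t _ => hasum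
  · simp
  · refine Eventually.of_forall fun t _ => HasSum.mul_left _ ?_
    have hs : LSeriesSummable (fun n => (ArithmeticFunction.vonMangoldt n : ℂ))
        (σ + (l * t : ℝ) * Complex.I) :=
      ArithmeticFunction.LSeriesSummable_vonMangoldt (by simpa)
    have : HasSum (LSeries.term _ _) (LSeries _ _) := hs.hasSum
    rwa [funext fun n => hterm n (l * t)] at this

lemma integral_exp_mul_inv_eq {δ : ℝ} (hδ : 0 < δ) (l x : ℝ) :
    ∫ t in (0 : ℝ)..1, ((1 - t : ℝ) : ℂ) * Complex.exp ((l * x * t : ℝ) * Complex.I) *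
        (1 / (δ + (l * t : ℝ) * Complex.I)) =
      ∫ u in Set.Ioi (0 : ℝ), (Real.exp (-δ * u) : ℂ) * fejerHalf (l * (u - x)) := by
  have h1 : ∀ t : ℝ, (1 / (δ + (l * t : ℝ) * Complex.I)) =
      ∫ u in Set.Ioi (0 : ℝ), Complex.exp (-(δ + (l * t : ℝ) * Complex.I) * u) := by
    intro t
    rw [integral_exp_mul_complex_Ioi (by simpa)]
    rw [Complex.ofReal_zero, mul_zero, Complex.exp_zero, neg_div_neg_eq]
  simp_rw [h1, ← MeasureTheory.integral_const_mul]
  have hexp : MeasureTheory.IntegrableOn (fun u => Real.exp (-δ * u)) (Set.Ioi 0) :=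
    integrableOn_exp_mul_Ioi (by linarith) 0
  rw [MeasureTheory.intervalIntegral_integral_swap]
  · refine MeasureTheory.integral_congr_ae (Eventually.of_forall fun u => ?_)
    simp only [fejerHalf]
    rw [← intervalIntegral.integral_const_mul]
    refine intervalIntegral.integral_congr fun t _ => ?_
    rw [mul_assoc, ← Complex.exp_add, mul_left_comm, Complex.ofReal_exp, ← Complex.exp_add]
    push_cast
    ring_nf
  · rw [Set.uIoc_of_le zero_le_one]
    have hb : MeasureTheory.Integrable (fun p : ℝ × ℝ => (1 : ℝ) * Real.exp (-δ * p.2))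
        ((MeasureTheory.volume.restrict (Set.Ioc (0 : ℝ) 1)).prod
          (MeasureTheory.volume.restrict (Set.Ioi 0))) :=
      MeasureTheory.Integrable.mul_prod (f := fun _ => (1 : ℝ)) (by simp) hexp
    refine hb.mono (Continuous.aestronglyMeasurable (by fun_prop)) ?_
    rw [MeasureTheory.Measure.prod_restrict]
    refine (MeasureTheory.ae_restrict_mem (measurableSet_Ioc.prod measurableSet_Ioi)).mono ?_
    rintro ⟨t, u⟩ ⟨ht, hu⟩
    have e : (-(δ + (l * t : ℝ) * Complex.I) * u : ℂ).re = -δ * u := by simp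
    simp only [Function.uncurry_apply_pair, norm_mul, Complex.norm_real,
      Complex.norm_exp_ofReal_mul_I, mul_one, Complex.norm_exp (_ * (u : ℂ)), e,
      Real.norm_eq_abs, Real.abs_exp, abs_one]
    refine mul_le_mul_of_nonneg_right ?_ (Real.exp_pos _).le
    rw [abs_of_nonneg] <;> linarith [ht.1, ht.2]

lemma le_re_integral_exp_mul_inv {δ l x : ℝ} (hδ : 0 < δ) (hl : 0 < l) (hx : 0 ≤ x) :
    Real.exp (-δ * (x + 1 / l)) * (1 / (4 * l)) ≤
      (∫ t in (0 : ℝ)..1, ((1 - t : ℝ) : ℂ) * Complex.exp ((l * x * t : ℝ) * Complex.I) *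
        (1 / (δ + (l * t : ℝ) * Complex.I))).re := by
  rw [integral_exp_mul_inv_eq hδ]
  have hexp : MeasureTheory.IntegrableOn (fun u => Real.exp (-δ * u)) (Set.Ioi 0) :=
    integrableOn_exp_mul_Ioi (by linarith) 0
  have hfc := continuous_fejerHalf
  have hnorm : ∀ u, ‖fejerHalf u‖ ≤ 1 := by
    intro u
    have := intervalIntegral.norm_integral_le_of_norm_le_const (a := (0 : ℝ)) (b := 1) (C := 1)
      (f := fun t : ℝ => ((1 - t : ℝ) : ℂ) * Complex.exp (-((u * t : ℝ) * Complex.I))) ?_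
    · exact this.trans_eq (by norm_num)
    · intro t ht
      rw [Set.uIoc_of_le zero_le_one] at ht
      rw [norm_mul, ← neg_mul, ← Complex.ofReal_neg, Complex.norm_exp_ofReal_mul_I, mul_one,
        Complex.norm_real, Real.norm_of_nonneg] <;> linarith [ht.1, ht.2]
  have hint : MeasureTheory.IntegrableOn
      (fun u => (Real.exp (-δ * u) : ℂ) * fejerHalf (l * (u - x))) (Set.Ioi 0) := by
    refine MeasureTheory.Integrable.mono hexp (Continuous.aestronglyMeasurable (by fun_prop))
      (Eventually.of_forall fun u => ?_)
    rw [norm_mul, Complex.norm_real]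
    exact mul_le_of_le_one_right (norm_nonneg _) (hnorm _)
  have hre := Complex.reCLM.integral_comp_comm hint
  simp only [Complex.reCLM_apply, Complex.re_ofReal_mul] at hre
  have hint' := hint.re
  simp only [RCLike.re_to_complex, Complex.re_ofReal_mul] at hint'
  rw [← hre]
  calc Real.exp (-δ * (x + 1 / l)) * (1 / (4 * l))
      = ∫ u in Set.Ioc x (x + 1 / l), Real.exp (-δ * (x + 1 / l)) * (1 / 4) := by
        simp [MeasureTheory.measureReal_restrict_apply, hl.le]
        ring
    _ ≤ ∫ u in Set.Ioc x (x + 1 / l), Real.exp (-δ * u) * (fejerHalf (l * (u - x))).re := by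
        refine MeasureTheory.setIntegral_mono_on (MeasureTheory.integrableOn_const (by simp))
          (MeasureTheory.IntegrableOn.mono_set hint' fun u hu => hx.trans_lt hu.1)
          measurableSet_Ioc fun u hu => ?_
        have h1 : l * (u - x) ≤ 1 := by
          have : u - x ≤ 1 / l := by linarith [hu.2]
          calc l * (u - x) ≤ l * (1 / l) := by gcongr
            _ = 1 := by field_simp
        refine mul_le_mul (Real.exp_le_exp.2 ?_)
          (quarter_le_fejerHalf_re (mul_nonneg hl.le (by linarith [hu.1])) h1) (by norm_num)
          (Real.exp_pos _).le
        nlinarith [hu.2]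
    _ ≤ _ := by
        refine MeasureTheory.setIntegral_mono_set hint' ?_
          (LE.le.eventuallyLE fun u hu => hx.trans_lt hu.1)
        exact Eventually.of_forall fun u => mul_nonneg (Real.exp_pos _).le (fejerHalf_re_nonneg _)

lemma summable_int_one_div_one_add_sq : Summable fun j : ℤ => 1 / (1 + (j : ℝ) ^ 2) := by
  have h1 : Summable fun j : ℤ => 1 / (j : ℝ) ^ 2 := Real.summable_one_div_int_pow.2 one_lt_two
  have h2 : Summable fun j : ℤ => if j = 0 then (1 : ℝ) else 0 :=
    (hasSum_ite_eq (0 : ℤ) (1 : ℝ)).summable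
  refine Summable.of_nonneg_of_le (fun j => by positivity) (fun j => ?_) (h1.add h2)
  rcases eq_or_ne j 0 with rfl | hj
  · simp
  · have : (0 : ℝ) < (j : ℝ) ^ 2 := by positivity
    simp only [hj, if_false, add_zero]
    gcongr
    linarith

/-- By Chebyshev's upper bound, `∑ Λ(n) / n` against a quadratically decaying weight centred at
`log n = y` is bounded uniformly in `y`. -/
lemma exists_sum_vonMangoldt_div_le : ∃ D : ℝ, 0 ≤ D ∧ ∀ (y : ℝ) (s : Finset ℕ),
    ∑ n ∈ s, ArithmeticFunction.vonMangoldt n / n * (1 / (1 + (Real.log n - y) ^ 2)) ≤ D := by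
  set C : ℝ := 3 * ((Real.log 4 + 4) * Real.exp 1) with hC
  have hC0 : 0 ≤ C := by positivity
  refine ⟨∑' j : ℤ, C * (1 / (1 + (j : ℝ) ^ 2)), tsum_nonneg fun j => by positivity,
    fun y s => ?_⟩
  let g : ℕ → ℤ := fun n => ⌊Real.log n - y⌋
  rw [← Finset.sum_fiberwise_of_maps_to (t := s.image g) (g := g)
    fun n hn => Finset.mem_image_of_mem _ hn]
  refine le_trans (Finset.sum_le_sum fun j _ => ?_)
    ((summable_int_one_div_one_add_sq.mul_left C).sum_le_tsum _ fun j _ => by positivity)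
  have hbound : ∀ n ∈ s.filter (fun n => g n = j),
      ArithmeticFunction.vonMangoldt n / n * (1 / (1 + (Real.log n - y) ^ 2)) ≤
        Real.exp (-(y + j)) * (3 * (1 / (1 + (j : ℝ) ^ 2))) * ArithmeticFunction.vonMangoldt n := by
    intro n hn
    have hg : ⌊Real.log n - y⌋ = j := (Finset.mem_filter.1 hn).2
    obtain ⟨h1, h2⟩ := Int.floor_eq_iff.1 hg
    rcases Nat.eq_zero_or_pos n with rfl | hn0
    · simp
    have hn' : (0 : ℝ) < n := by exact_mod_cast hn0
    have hexp : Real.exp (y + j) ≤ n := by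
      rw [← Real.le_log_iff_exp_le hn']; linarith
    have hq : 1 / (1 + (Real.log n - y) ^ 2) ≤ 3 * (1 / (1 + (j : ℝ) ^ 2)) := by
      rw [mul_one_div, div_le_div_iff₀ (by positivity) (by positivity)]
      nlinarith [sq_nonneg (2 * (Real.log n - y) - j)]
    have hi : 1 / (n : ℝ) ≤ Real.exp (-(y + j)) := by
      rw [Real.exp_neg, ← one_div]
      exact one_div_le_one_div_of_le (Real.exp_pos _) hexp
    calc ArithmeticFunction.vonMangoldt n / n * (1 / (1 + (Real.log n - y) ^ 2))
        = 1 / n * (1 / (1 + (Real.log n - y) ^ 2)) * ArithmeticFunction.vonMangoldt n := by ring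
      _ ≤ _ := mul_le_mul_of_nonneg_right
          (mul_le_mul hi hq (by positivity) (Real.exp_pos _).le)
          ArithmeticFunction.vonMangoldt_nonneg
  have hpsi : ∑ n ∈ s.filter (fun n => g n = j), ArithmeticFunction.vonMangoldt n ≤
      (Real.log 4 + 4) * Real.exp (y + j + 1) := by
    refine le_trans ?_ (Chebyshev.psi_le_const_mul_self (Real.exp_pos _).le)
    rw [Chebyshev.psi_eq_sum_Icc]
    refine Finset.sum_le_sum_of_subset_of_nonneg (fun n hn => ?_)
      fun _ _ _ => ArithmeticFunction.vonMangoldt_nonneg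
    have hg : ⌊Real.log n - y⌋ = j := (Finset.mem_filter.1 hn).2
    obtain ⟨h1, h2⟩ := Int.floor_eq_iff.1 hg
    refine Finset.mem_Icc.2 ⟨Nat.zero_le _, Nat.le_floor ?_⟩
    rcases Nat.eq_zero_or_pos n with rfl | hn0
    · simpa using (Real.exp_pos _).le
    · rw [← Real.log_le_iff_le_exp (by exact_mod_cast hn0)]
      linarith
  refine (Finset.sum_le_sum hbound).trans ?_
  rw [← Finset.mul_sum]
  calc _ ≤ Real.exp (-(y + j)) * (3 * (1 / (1 + (j : ℝ) ^ 2))) *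
        ((Real.log 4 + 4) * Real.exp (y + j + 1)) := by gcongr
    _ = (Real.exp (-(y + j)) * Real.exp (y + j)) * (C * (1 / (1 + (j : ℝ) ^ 2))) := by
        rw [Real.exp_add (y + j) 1, hC]; ring
    _ = _ := by rw [← Real.exp_add]; simp

lemma Chebyshev.sum_Ioc_vonMangoldt {a b : ℝ} (hab : a ≤ b) :
    ∑ n ∈ Finset.Ioc ⌊a⌋₊ ⌊b⌋₊, ArithmeticFunction.vonMangoldt n =
      Chebyshev.psi b - Chebyshev.psi a := by
  rw [Chebyshev.psi, Chebyshev.psi, eq_sub_iff_add_eq']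
  exact Finset.sum_Ioc_consecutive _ (Nat.zero_le _) (Nat.floor_mono hab)

lemma exists_integral_LSeries_re_le {η : ℝ} (hη : 0 < η) : ∃ D : ℝ, 0 ≤ D ∧
    ∀ σ l x : ℝ, 1 < σ → 0 < l →
      (∫ t in (0 : ℝ)..1, ((1 - t : ℝ) : ℂ) * Complex.exp ((l * x * t : ℝ) * Complex.I) *
        LSeries (fun n => (ArithmeticFunction.vonMangoldt n : ℂ))
          (σ + (l * t : ℝ) * Complex.I)).re ≤
      Real.exp (-(x - η)) / 2 *
        (Chebyshev.psi (Real.exp (x + η)) - Chebyshev.psi (Real.exp (x - η))) + D / l ^ 2 := by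
  obtain ⟨D, hD0, hD⟩ := exists_sum_vonMangoldt_div_le
  refine ⟨2 * (1 + 1 / η ^ 2) * D, by positivity, fun σ l x hσ hl => ?_⟩
  have hS := Complex.hasSum_re (hasSum_vonMangoldt_mul_fejerHalf hσ l x)
  simp only [Complex.re_ofReal_mul] at hS
  refine hasSum_le_of_sum_le hS fun s => ?_
  set I := Finset.Ioc ⌊Real.exp (x - η)⌋₊ ⌊Real.exp (x + η)⌋₊ with hI
  have hterm : ∀ n ∈ s, ArithmeticFunction.vonMangoldt n * (n : ℝ) ^ (-σ) *
      (fejerHalf (l * (Real.log n - x))).re ≤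
      (if n ∈ I then Real.exp (-(x - η)) / 2 * ArithmeticFunction.vonMangoldt n else 0) +
        2 * (1 + 1 / η ^ 2) / l ^ 2 *
          (ArithmeticFunction.vonMangoldt n / n * (1 / (1 + (Real.log n - x) ^ 2))) := by
    intro n _
    have hL : 0 ≤ ArithmeticFunction.vonMangoldt n := ArithmeticFunction.vonMangoldt_nonneg
    rcases Nat.eq_zero_or_pos n with rfl | hn0
    · simp
    have hn' : (0 : ℝ) < n := by exact_mod_cast hn0
    have hpow : (n : ℝ) ^ (-σ) ≤ 1 / n := by
      rw [one_div, ← Real.rpow_neg_one]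
      exact Real.rpow_le_rpow_of_exponent_le (by exact_mod_cast hn0) (by linarith)
    rcases lt_or_ge |Real.log n - x| η with h | h
    · obtain ⟨h1, h2⟩ := abs_lt.1 h
      have hlow : Real.exp (x - η) < n := by rw [← Real.lt_log_iff_exp_lt hn']; linarith
      have hup : (n : ℝ) < Real.exp (x + η) := by rw [← Real.log_lt_iff_lt_exp hn']; linarith
      have hmem : n ∈ I := by
        rw [hI, Finset.mem_Ioc]
        exact ⟨(Nat.floor_lt (Real.exp_pos _).le).2 hlow, Nat.le_floor hup.le⟩
      rw [if_pos hmem]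
      have hi : (n : ℝ) ^ (-σ) ≤ Real.exp (-(x - η)) := by
        refine hpow.trans ?_
        rw [Real.exp_neg, ← one_div]
        exact one_div_le_one_div_of_le (Real.exp_pos _) hlow.le
      calc _ ≤ ArithmeticFunction.vonMangoldt n * Real.exp (-(x - η)) * (1 / 2) := by
            gcongr
            · exact fejerHalf_re_nonneg _
            · exact fejerHalf_re_le_half _
        _ = Real.exp (-(x - η)) / 2 * ArithmeticFunction.vonMangoldt n + 0 := by ring
        _ ≤ _ := by gcongr; positivity
    · have hu : Real.log n - x ≠ 0 := fun h0 => by rw [h0, abs_zero] at h; linarith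
      have hu2 : η ^ 2 ≤ (Real.log n - x) ^ 2 := by
        rw [← sq_abs (Real.log n - x)]; gcongr
      have hK : (fejerHalf (l * (Real.log n - x))).re ≤
          2 * (1 + 1 / η ^ 2) / l ^ 2 * (1 / (1 + (Real.log n - x) ^ 2)) := by
        refine (fejerHalf_re_le _ (mul_ne_zero hl.ne' hu)).trans ?_
        generalize Real.log n - x = u at *
        have hu0 : 0 < u ^ 2 := by positivity
        have : 1 ≤ u ^ 2 * (1 / η ^ 2) := by
          rw [mul_one_div, one_le_div (by positivity)]; exact hu2
        rw [div_mul_div_comm, mul_one, div_le_div_iff₀ (by positivity) (by positivity)]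
        have hl2 : 0 < l ^ 2 := by positivity
        calc 2 * (l ^ 2 * (1 + u ^ 2)) = 2 * l ^ 2 * (1 + u ^ 2) := by ring
          _ ≤ 2 * l ^ 2 * (u ^ 2 * (1 / η ^ 2) + u ^ 2) := by gcongr
          _ = _ := by ring
      calc _ ≤ ArithmeticFunction.vonMangoldt n * (1 / n) *
            (2 * (1 + 1 / η ^ 2) / l ^ 2 * (1 / (1 + (Real.log n - x) ^ 2))) := by
            gcongr
            exact fejerHalf_re_nonneg _
        _ = 0 + 2 * (1 + 1 / η ^ 2) / l ^ 2 *
          (ArithmeticFunction.vonMangoldt n / n * (1 / (1 + (Real.log n - x) ^ 2))) := by ring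
        _ ≤ _ := by gcongr; split_ifs <;> positivity
  refine (Finset.sum_le_sum hterm).trans ?_
  rw [Finset.sum_add_distrib, ← Finset.mul_sum]
  refine add_le_add ?_ ?_
  · rw [← Finset.sum_filter, ← Finset.mul_sum,
      ← Chebyshev.sum_Ioc_vonMangoldt (Real.exp_le_exp.2 (by linarith))]
    refine mul_le_mul_of_nonneg_left ?_ (by positivity)
    exact Finset.sum_le_sum_of_subset_of_nonneg (fun n hn => (Finset.mem_filter.1 hn).2)
      fun _ _ _ => ArithmeticFunction.vonMangoldt_nonneg
  · calc _ ≤ 2 * (1 + 1 / η ^ 2) / l ^ 2 * D := by gcongr; exact hD x s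
      _ = _ := by ring

lemma exists_continuousOn_LSeries_vonMangoldt_eq : ∃ G : ℂ → ℂ,
    ContinuousOn G {s | 1 ≤ s.re} ∧ ∀ s : ℂ, 1 < s.re →
      LSeries (fun n => (ArithmeticFunction.vonMangoldt n : ℂ)) s = G s + 1 / (s - 1) := by
  refine ⟨ArithmeticFunction.vonMangoldt.LFunctionResidueClassAux (1 : ZMod 1),
    ArithmeticFunction.vonMangoldt.continuousOn_LFunctionResidueClassAux _, fun s hs => ?_⟩
  have h := ArithmeticFunction.vonMangoldt.eqOn_LFunctionResidueClassAux
    (isUnit_one : IsUnit (1 : ZMod 1)) hs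
  have hr : (fun n : ℕ => (ArithmeticFunction.vonMangoldt.residueClass (1 : ZMod 1) n : ℂ)) =
      fun n => (ArithmeticFunction.vonMangoldt n : ℂ) := by
    ext n
    rw [ArithmeticFunction.vonMangoldt.residueClass, Set.indicator_of_mem]
    exact Subsingleton.elim _ _
  rw [h]
  simp [hr]

lemma tendsto_integral_exp_mul_atTop {f : ℝ → ℂ} {l : ℝ} (hl : 0 < l) :
    Tendsto (fun x : ℝ => ∫ t in (0 : ℝ)..1, Complex.exp ((l * x * t : ℝ) * Complex.I) * f t)
      atTop (nhds 0) := by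
  have h := Real.tendsto_integral_exp_smul_cocompact (Set.indicator (Set.Ioc (0 : ℝ) 1) f)
  have hw : Tendsto (fun x : ℝ => -(l / (2 * Real.pi)) * x) atTop (cocompact ℝ) :=
    (tendsto_id.const_mul_atTop_of_neg (by simp only [neg_lt_zero]; positivity)).mono_right
      atBot_le_cocompact
  refine (h.comp hw).congr fun x => ?_
  rw [intervalIntegral.integral_of_le zero_le_one,
    ← MeasureTheory.integral_indicator measurableSet_Ioc]
  refine MeasureTheory.integral_congr_ae (Eventually.of_forall fun t => ?_)
  by_cases ht : t ∈ Set.Ioc (0 : ℝ) 1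
  · simp only [Set.indicator_of_mem ht, Circle.smul_def, Real.fourierChar_apply, smul_eq_mul]
    congr 4
    field_simp
  · simp [Set.indicator_of_notMem ht]

lemma eventually_le_psi_sub_psi {η : ℝ} (hη : 0 < η) : ∃ c : ℝ, 0 < c ∧ ∀ᶠ x in atTop,
    c * Real.exp x ≤ Chebyshev.psi (Real.exp (x + η)) - Chebyshev.psi (Real.exp (x - η)) := by
  obtain ⟨D, hD0, hD⟩ := exists_integral_LSeries_re_le hη
  obtain ⟨G, hG, hGL⟩ := exists_continuousOn_LSeries_vonMangoldt_eq
  set l : ℝ := 16 * D + 1 with hl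
  have hl0 : 0 < l := by positivity
  have hGc : Continuous fun p : ℝ × ℝ => G ((max p.1 1 : ℝ) + (l * p.2 : ℝ) * Complex.I) :=
    hG.comp_continuous (by fun_prop) fun p => by simp
  let R : ℝ → ℝ → ℂ := fun x σ => ∫ t in (0 : ℝ)..1,
    Complex.exp ((l * x * t : ℝ) * Complex.I) *
      (((1 - t : ℝ) : ℂ) * G ((max σ 1 : ℝ) + (l * t : ℝ) * Complex.I))
  have hRc : ∀ x, Continuous (R x) := fun x =>
    intervalIntegral.continuous_parametric_intervalIntegral_of_continuous'
      (f := fun σ t : ℝ => Complex.exp ((l * x * t : ℝ) * Complex.I) *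
        (((1 - t : ℝ) : ℂ) * G ((max σ 1 : ℝ) + (l * t : ℝ) * Complex.I)))
      (by
        refine Continuous.mul (by fun_prop) (Continuous.mul (by fun_prop) ?_)
        exact hGc) 0 1
  set Δ : ℝ → ℝ := fun x =>
    Chebyshev.psi (Real.exp (x + η)) - Chebyshev.psi (Real.exp (x - η)) with hΔ
  have hmain : ∀ x, 0 ≤ x → (R x 1).re + 1 / (4 * l) ≤
      Real.exp (-(x - η)) / 2 * Δ x + D / l ^ 2 := by
    intro x hx
    have hσ : ∀ σ : ℝ, 1 < σ → (R x σ).re + Real.exp (-(σ - 1) * (x + 1 / l)) * (1 / (4 * l)) ≤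
        Real.exp (-(x - η)) / 2 * Δ x + D / l ^ 2 := by
      intro σ hσ
      refine le_trans ?_ (hD σ l x hσ hl0)
      have hne : ∀ t : ℝ, (((σ - 1 : ℝ) : ℂ) + (l * t : ℝ) * Complex.I) ≠ 0 := fun t h => by
        have := congrArg Complex.re h
        simp only [Complex.add_re, Complex.ofReal_re, Complex.re_ofReal_mul, Complex.I_re,
          mul_zero, add_zero, Complex.zero_re] at this
        linarith
      have hsplit : (∫ t in (0 : ℝ)..1, ((1 - t : ℝ) : ℂ) *
          Complex.exp ((l * x * t : ℝ) * Complex.I) *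
          LSeries (fun n => (ArithmeticFunction.vonMangoldt n : ℂ))
            (σ + (l * t : ℝ) * Complex.I)) = R x σ +
          ∫ t in (0 : ℝ)..1, ((1 - t : ℝ) : ℂ) * Complex.exp ((l * x * t : ℝ) * Complex.I) *
            (1 / ((σ - 1 : ℝ) + (l * t : ℝ) * Complex.I)) := by
        rw [← intervalIntegral.integral_add]
        · refine intervalIntegral.integral_congr fun t _ => ?_
          rw [hGL _ (by simpa), max_eq_left hσ.le]
          push_cast
          ring
        · refine Continuous.intervalIntegrable ?_ _ _
          refine Continuous.mul (by fun_prop) (Continuous.mul (by fun_prop) ?_)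
          exact hGc.comp (by fun_prop : Continuous fun t : ℝ => (σ, t))
        · refine Continuous.intervalIntegrable ?_ _ _
          refine Continuous.mul (by fun_prop) (Continuous.div (by fun_prop) (by fun_prop) hne)
      rw [hsplit, Complex.add_re]
      gcongr
      exact le_re_integral_exp_mul_inv (by linarith) hl0 hx
    have hlim : Tendsto (fun σ : ℝ => (R x σ).re +
        Real.exp (-(σ - 1) * (x + 1 / l)) * (1 / (4 * l))) (nhdsWithin 1 (Set.Ioi 1))
        (nhds ((R x 1).re + 1 / (4 * l))) := by
      have hc : Continuous fun σ : ℝ => (R x σ).re +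
          Real.exp (-(σ - 1) * (x + 1 / l)) * (1 / (4 * l)) := by
        have := hRc x
        fun_prop
      have := (hc.tendsto 1).mono_left (nhdsWithin_le_nhds (s := Set.Ioi 1))
      simpa using this
    exact le_of_tendsto hlim (eventually_mem_nhdsWithin.mono hσ)
  have hR : Tendsto (fun x => R x 1) atTop (nhds 0) := tendsto_integral_exp_mul_atTop hl0
  have hDl : D / l ^ 2 ≤ 1 / (16 * l) := by
    rw [div_le_div_iff₀ (by positivity) (by positivity)]
    nlinarith
  refine ⟨Real.exp (-η) / (4 * l), by positivity, ?_⟩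
  filter_upwards [eventually_ge_atTop 0, hR.norm.eventually
    (gt_mem_nhds (show ‖(0 : ℂ)‖ < 1 / (16 * l) by rw [norm_zero]; positivity))] with x hx hRx
  have h1 := hmain x hx
  have h2 := (abs_le.1 ((Complex.abs_re_le_norm (R x 1)).trans hRx.le)).1
  have h3 : 1 / (8 * l) ≤ Real.exp (-(x - η)) / 2 * Δ x := by
    have e1 : 1 / (4 * l) = 4 * (1 / (16 * l)) := by ring
    have e2 : 1 / (8 * l) = 2 * (1 / (16 * l)) := by ring
    linarith
  have h4 : Real.exp (x - η) * Real.exp (-(x - η)) = 1 := by rw [← Real.exp_add]; simp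
  calc Real.exp (-η) / (4 * l) * Real.exp x = 2 * Real.exp (x - η) * (1 / (8 * l)) := by
        rw [sub_eq_add_neg, Real.exp_add]; ring
    _ ≤ 2 * Real.exp (x - η) * (Real.exp (-(x - η)) / 2 * Δ x) := by gcongr
    _ = (Real.exp (x - η) * Real.exp (-(x - η))) * Δ x := by ring
    _ = Δ x := by rw [h4, one_mul]

lemma eventually_exists_prime_exp {η : ℝ} (hη : 0 < η) : ∀ᶠ x : ℝ in atTop,
    ∃ p : ℕ, p.Prime ∧ Real.exp (x - η) < p ∧ (p : ℝ) ≤ Real.exp (x + η) := by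
  obtain ⟨c, hc, hpsi⟩ := eventually_le_psi_sub_psi hη
  obtain ⟨C, hC⟩ := Chebyshev.psi_sub_theta_le_mul_sqrt
  have hlim : Tendsto (fun x : ℝ => Real.exp (x / 2)) atTop atTop :=
    Real.tendsto_exp_atTop.comp (tendsto_id.atTop_div_const two_pos)
  filter_upwards [hpsi, hlim.eventually_gt_atTop (C * Real.exp (η / 2) / c)] with x h1 h2
  by_contra! hno
  have htheta : Chebyshev.theta (Real.exp (x + η)) = Chebyshev.theta (Real.exp (x - η)) := by
    rw [Chebyshev.theta, Chebyshev.theta]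
    refine Finset.sum_congr (Finset.ext fun p => ?_) fun _ _ => rfl
    simp only [Finset.mem_filter, Finset.mem_Ioc, Nat.le_floor_iff (Real.exp_pos _).le]
    refine ⟨fun ⟨⟨h0, hp⟩, hpp⟩ => ⟨⟨h0, not_lt.1 fun h => (hno p hpp h).not_ge hp⟩, hpp⟩,
      fun ⟨⟨h0, hp⟩, hpp⟩ => ⟨⟨h0, hp.trans (Real.exp_le_exp.2 (by linarith))⟩, hpp⟩⟩
  have h3 := hC (Real.exp (x + η))
  have h4 := Chebyshev.theta_le_psi (Real.exp (x - η))
  rw [div_lt_iff₀ hc] at h2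
  have h5 : C * √(Real.exp (x + η)) < c * Real.exp x := by
    rw [← Real.exp_half, add_div, Real.exp_add]
    calc C * (Real.exp (x / 2) * Real.exp (η / 2))
        = C * Real.exp (η / 2) * Real.exp (x / 2) := by ring
      _ < Real.exp (x / 2) * c * Real.exp (x / 2) := by gcongr
      _ = c * Real.exp (x / 2 + x / 2) := by rw [Real.exp_add]; ring
      _ = c * Real.exp x := by rw [add_halves]
  linarith

theorem nth_prime_ratio_tendsto_one :
    Tendsto (fun n => (Nat.nth Nat.Prime (n + 1) : ℝ) / (Nat.nth Nat.Prime n : ℝ))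
      atTop (nhds 1) := by
  have hpos : ∀ n, (0 : ℝ) < Nat.nth Nat.Prime n := fun n => by
    exact_mod_cast (Nat.prime_nth_prime n).pos
  have htop : Tendsto (fun n => (Nat.nth Nat.Prime n : ℝ)) atTop atTop :=
    tendsto_natCast_atTop_atTop.comp
      (Nat.nth_strictMono Nat.infinite_setOfPred_prime).tendsto_atTop
  refine tendsto_order.2 ⟨fun a ha => Eventually.of_forall fun n => ?_, fun b hb => ?_⟩
  · refine ha.trans_le ((one_le_div (hpos n)).2 ?_)
    exact_mod_cast (Nat.nth_strictMono Nat.infinite_setOfPred_prime n.lt_succ_self).le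
  · obtain ⟨b', hb1, hb2⟩ := exists_between hb
    have hη : 0 < Real.log b' / 2 := half_pos (Real.log_pos hb1)
    have hx : Tendsto (fun n => Real.log (Nat.nth Nat.Prime n) + Real.log b' / 2) atTop atTop :=
      tendsto_atTop_add_const_right _ _ (Real.tendsto_log_atTop.comp htop)
    filter_upwards [hx.eventually (eventually_exists_prime_exp hη)] with n hn
    obtain ⟨p, hp, h1, h2⟩ := hn
    rw [add_sub_cancel_right, Real.exp_log (hpos n)] at h1
    rw [add_assoc, add_halves, Real.exp_add, Real.exp_log (hpos n),
      Real.exp_log (zero_lt_one.trans hb1)] at h2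
    have hle : Nat.nth Nat.Prime (n + 1) ≤ p := by
      by_contra! hlt
      have := Nat.le_nth_of_lt_nth_succ hlt hp
      exact absurd h1 (not_lt.2 (by exact_mod_cast this))
    refine lt_of_le_of_lt ?_ hb2
    rw [div_le_iff₀ (hpos n), mul_comm]
    exact le_trans (by exact_mod_cast hle) h2
end
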